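/- arXiv:1011.1403 — 2 statements merged into one kernel-verified Lean document; each statement's English description precedes it below -/
import Mathlib

section
/- Let x, y ∈ ℤ_{-τ} be consecutive (-τ)-integers with x < y (no element of ℤ_{-τ} lies strictly between x and y) and y - x = 1/τ. Then [τ²·x, τ²·y] ∩ ℤ_{-τ} = {τ²·x, τ²·x + 1, τ²·x + 1 + 1/τ}, where τ²·y = τ²·x + 1 + 1/τ. -/
/-- The Ito–Sadahiro transformation `T_{-β}` on `[l_β, r_β)`, where
`l_β = -β/(β+1)` and `r_β = 1/(β+1)`. -/
noncomputable def negT (β : ℝ) (x : ℝ) : ℝ :=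
  -β * x - (⌊-β * x - (-β / (β + 1))⌋ : ℝ)

/-- `Fin(-β)`: reals `x` such that `(-β)^k * x ∈ (l_β, r_β)` for some `k : ℤ`
and some iterate of `T_{-β}` sends it to `0`. -/
def negFin (β : ℝ) (x : ℝ) : Prop :=
  ∃ (k : ℤ) (n : ℕ), ((-β) ^ k * x ∈ Set.Ioo (-β / (β + 1)) (1 / (β + 1))) ∧
    (negT β)^[n] ((-β) ^ k * x) = 0

/-- The set `ℤ_{-β}` of `(-β)`-integers. -/
def negInt (β : ℝ) (x : ℝ) : Prop :=
  x = 0 ∨ ∃ (N : ℕ) (y : ℝ), y ∈ Set.Ioo (-β / (β + 1)) (1 / (β + 1)) ∧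
    x = (-β) ^ (N + 1) * y ∧ (negT β)^[N + 1] y = 0

/-- The `(-β)`-digit `d_{i+1}(y)` of `y ∈ [l_β, r_β)` (indices shifted so that
`negDigit β y i` is the digit `d_{i+1}(y)`). -/
noncomputable def negDigit (β : ℝ) (y : ℝ) (i : ℕ) : ℤ :=
  ⌊-β * ((negT β)^[i] y) - (-β / (β + 1))⌋

/-- The golden ratio `τ = (1+√5)/2`. -/
noncomputable def tau : ℝ := (1 + Real.sqrt 5) / 2

/-- The Rényi transformation `T_β` on `[0,1)`. -/
noncomputable def renyiT (β : ℝ) (x : ℝ) : ℝ := β * x - (⌊β * x⌋ : ℝ)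

/-- The set `ℤ_β` of (nonnegative) `β`-integers. -/
def posInt (β : ℝ) (x : ℝ) : Prop :=
  x = 0 ∨ ∃ N : ℕ, (β ^ (-(N + 1 : ℤ)) * x ∈ Set.Ico (0 : ℝ) 1) ∧
    (renyiT β)^[N + 1] (β ^ (-(N + 1 : ℤ)) * x) = 0

/-- The golden ratio is a root of `x ^ 2 - x - 1`. -/
theorem tau_sq : tau ^ 2 = tau + 1 := Real.goldenRatio_sq

theorem lt_tau : 1.6 < tau := by
  have h : (2.2 : ℝ) < Real.sqrt 5 := Real.lt_sqrt_of_sq_lt (by norm_num)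
  unfold tau
  linarith

theorem tau_lt : tau < 1.62 := by
  have h : Real.sqrt 5 < 2.24 := (Real.sqrt_lt' (by norm_num)).2 (by norm_num)
  unfold tau
  linarith

theorem one_div_tau : 1 / tau = tau - 1 := by
  have h : tau ≠ 0 := by linarith [lt_tau]
  rw [div_eq_iff h]
  linarith [tau_sq]

theorem neg_tau_div_tau_add_one : -tau / (tau + 1) = 1 - tau := by
  have h : tau + 1 ≠ 0 := by linarith [lt_tau]
  rw [div_eq_iff h]
  linarith [tau_sq]

theorem one_div_tau_add_one : 1 / (tau + 1) = 2 - tau := by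
  have h : tau + 1 ≠ 0 := by linarith [lt_tau]
  rw [div_eq_iff h]
  linarith [tau_sq]

/-- The numbers `1` and `τ` are linearly independent over `ℤ`. -/
theorem int_add_int_mul_tau_inj {a b c d : ℤ} (h : (a : ℝ) + b * tau = c + d * tau) :
    a = c ∧ b = d := by
  have hbd : b = d := by
    by_contra hne
    have hirr : Irrational (((b - d : ℤ) : ℝ) * tau) :=
      Real.goldenRatio_irrational.intCast_mul (sub_ne_zero.2 hne)
    refine hirr.ne_int (c - a) ?_
    push_cast
    linarith
  subst hbd
  exact ⟨by exact_mod_cast add_right_cancel h, rfl⟩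

/-- One step of `T_{-τ}` stays in `[l, r)` and subtracts a digit `0` or `1`. -/
theorem negT_tau_step {v : ℝ} (hv : v ∈ Set.Ico (1 - tau) (2 - tau)) :
    negT tau v ∈ Set.Ico (1 - tau) (2 - tau) ∧
      (negT tau v = -tau * v ∨ negT tau v = -tau * v - 1) := by
  obtain ⟨h1, h2⟩ := hv
  have hτ := lt_tau
  have hsq := tau_sq
  have e : negT tau v = -tau * v - (⌊-tau * v - (1 - tau)⌋ : ℝ) := by
    rw [negT, neg_tau_div_tau_add_one]
  have f1 := Int.floor_le (-tau * v - (1 - tau))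
  have f2 := Int.lt_floor_add_one (-tau * v - (1 - tau))
  have b1 : -tau * v - (1 - tau) ≤ tau := by nlinarith
  have b2 : 0 < -tau * v - (1 - tau) := by nlinarith
  have g1 : ⌊-tau * v - (1 - tau)⌋ < 2 := Int.floor_lt.2 (by push_cast; linarith [tau_lt])
  have g2 : 0 ≤ ⌊-tau * v - (1 - tau)⌋ := Int.floor_nonneg.2 b2.le
  refine ⟨⟨by linarith, by linarith⟩, ?_⟩
  generalize ⌊-tau * v - (1 - tau)⌋ = d at *
  interval_cases d
  · left; simpa using e
  · right; simpa using e

/-- After `n` steps, `(-τ)^n u` is the current iterate plus an element of `ℤ[τ]` whose Galois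
conjugate lies in `[0, τ²)`; the conjugate is at least `1` if the iterate is the left endpoint. -/
theorem neg_tau_pow_mul_eq_iterate_add {u : ℝ} (hu : u ∈ Set.Ico (1 - tau) (2 - tau)) (n : ℕ) :
    (negT tau)^[n] u ∈ Set.Ico (1 - tau) (2 - tau) ∧
      ∃ a b : ℤ, (-tau) ^ n * u = (negT tau)^[n] u + (a + b * tau) ∧
        (a : ℝ) + b * (1 - tau) ∈ Set.Ico 0 (tau + 1) ∧
        (n ≠ 0 → (negT tau)^[n] u = 1 - tau → 1 ≤ (a : ℝ) + b * (1 - tau)) := by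
  have hτ := lt_tau
  have hsq := tau_sq
  induction n with
  | zero => exact ⟨hu, 0, 0, by simp, by simp; linarith, by simp⟩
  | succ n ih =>
    obtain ⟨hv, a, b, hab, ⟨hc0, hc1⟩, -⟩ := ih
    rw [Function.iterate_succ_apply']
    generalize (negT tau)^[n] u = v at *
    obtain ⟨hT, hd⟩ := negT_tau_step hv
    have hmul : (-tau) ^ (n + 1) * u = -tau * v - (b + (a + b) * tau) := by
      rw [pow_succ', mul_assoc, hab]
      linear_combination (-b : ℝ) * hsq
    have hconj : (-b : ℝ) + (-(a + b)) * (1 - tau) = (tau - 1) * (a + b * (1 - tau)) := by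
      linear_combination (b : ℝ) * hsq
    have k0 : 0 ≤ (tau - 1) * (a + b * (1 - tau)) := mul_nonneg (by linarith) hc0
    have k1 : (tau - 1) * (a + b * (1 - tau)) < tau := by nlinarith
    refine ⟨hT, ?_⟩
    rcases hd with hd | hd
    · refine ⟨-b, -(a + b), ?_, ?_, ?_⟩
      · rw [hmul, hd]; push_cast; ring
      · push_cast; rw [hconj]; exact ⟨k0, by linarith⟩
      · intro _ hl
        exfalso
        have := hv.2
        nlinarith
    · refine ⟨1 - b, -(a + b), ?_, ?_, ?_⟩
      · rw [hmul, hd]; push_cast; ring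
      · push_cast; constructor <;> linarith
      · intro _ _
        push_cast; linarith

/-- `ℤ_{-τ}` consists of the elements of `ℤ[τ]` whose Galois conjugate lies in `[0, τ²)`. -/
theorem negInt_tau_iff (x : ℝ) :
    negInt tau x ↔ ∃ a b : ℤ, x = a + b * tau ∧
      (a : ℝ) + b * (1 - tau) ∈ Set.Ico 0 (tau + 1) := by
  have hτ := lt_tau
  have hτ' := tau_lt
  have hsq := tau_sq
  unfold negInt
  rw [neg_tau_div_tau_add_one, one_div_tau_add_one]
  constructor
  · rintro (rfl | ⟨N, u, hu, rfl, hT⟩)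
    · exact ⟨0, 0, by simp, by simp; linarith⟩
    · obtain ⟨-, a, b, hab, hc, -⟩ :=
        neg_tau_pow_mul_eq_iterate_add (Set.Ioo_subset_Ico_self hu) (N + 1)
      exact ⟨a, b, by rw [hab, hT, zero_add], hc⟩
  · rintro ⟨a, b, hx, hc0, hc1⟩
    right
    obtain ⟨N, hN⟩ := pow_unbounded_of_one_lt (3 * |x|) (show 1 < tau by linarith)
    have hne : (-tau) ^ (N + 1) ≠ 0 := pow_ne_zero _ (by linarith)
    have hsmall : |x / (-tau) ^ (N + 1)| < 1 / 3 := by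
      have hp : 0 < tau ^ (N + 1) := by positivity
      rw [abs_div, abs_pow, abs_neg, abs_of_pos (by linarith : 0 < tau), div_lt_iff₀ hp, pow_succ]
      nlinarith [abs_nonneg x]
    obtain ⟨s1, s2⟩ := abs_lt.1 hsmall
    have hu : x / (-tau) ^ (N + 1) ∈ Set.Ioo (1 - tau) (2 - tau) :=
      ⟨by linarith, by linarith⟩
    refine ⟨N, _, hu, by field_simp, ?_⟩
    obtain ⟨⟨z0, z1⟩, c, d, hcd, ⟨hs0, hs1⟩, hend⟩ :=
      neg_tau_pow_mul_eq_iterate_add (Set.Ioo_subset_Ico_self hu) (N + 1)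
    rw [mul_div_cancel₀ _ hne] at hcd
    generalize (negT tau)^[N + 1] (x / (-tau) ^ (N + 1)) = z at *
    obtain ⟨A, hA⟩ : ∃ A : ℤ, A = a - c := ⟨_, rfl⟩
    obtain ⟨B, hB⟩ : ∃ B : ℤ, B = b - d := ⟨_, rfl⟩
    have hA' : (A : ℝ) = a - c := by rw [hA]; push_cast; ring
    have hB' : (B : ℝ) = b - d := by rw [hB]; push_cast; ring
    have hz : z = A + B * tau := by rw [hA', hB']; linarith
    have hzc : (A : ℝ) + B * (1 - tau) = (a + b * (1 - tau)) - (c + d * (1 - tau)) := by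
      rw [hA', hB']; ring
    have hB1 : B < 2 := by
      by_contra! h
      have : (2 : ℝ) ≤ B := by exact_mod_cast h
      nlinarith
    have hB2 : -2 < B := by
      by_contra! h
      have : (B : ℝ) ≤ -2 := by exact_mod_cast h
      nlinarith
    interval_cases B
    · have h1 : 0 < A := by
        have : (0 : ℝ) < A := by push_cast at hz; linarith
        exact_mod_cast this
      have h2 : A < 2 := by
        have : (A : ℝ) < 2 := by push_cast at hz; linarith
        exact_mod_cast this
      obtain rfl : A = 1 := by omega
      have := hend (by omega) (by push_cast at hz; linarith)
      push_cast at hzc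
      linarith
    · have h1 : -1 < A := by
        have : (-1 : ℝ) < A := by push_cast at hz; linarith
        exact_mod_cast this
      have h2 : A < 1 := by
        have : (A : ℝ) < 1 := by push_cast at hz; linarith
        exact_mod_cast this
      obtain rfl : A = 0 := by omega
      simpa using hz
    · have h1 : -3 < A := by
        have : (-3 : ℝ) < A := by push_cast at hz; linarith
        exact_mod_cast this
      have h2 : A < -1 := by
        have : (A : ℝ) < -1 := by push_cast at hz; linarith
        exact_mod_cast this
      obtain rfl : A = -2 := by omega
      push_cast at hzc
      linarith

/-- If `x < y` are consecutive `(-τ)`-integers at distance `1/τ`, then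
`[τ²x, τ²y] ∩ ℤ_{-τ} = {τ²x, τ²x + 1, τ²x + 1 + 1/τ}` with `τ²y = τ²x + 1 + 1/τ`. -/
theorem tau_sq_image_of_gap_inv_tau
    (x y : ℝ) (hx : negInt tau x) (hy : negInt tau y) (hxy : x < y)
    (hcons : ∀ w : ℝ, negInt tau w → w ∉ Set.Ioo x y) (hgap : y - x = 1 / tau) :
    Set.Icc (tau ^ 2 * x) (tau ^ 2 * y) ∩ {w : ℝ | negInt tau w}
        = {tau ^ 2 * x, tau ^ 2 * x + 1, tau ^ 2 * x + 1 + 1 / tau} ∧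
      tau ^ 2 * y = tau ^ 2 * x + 1 + 1 / tau := by
  have hτ := lt_tau
  have hτ' := tau_lt
  have hsq := tau_sq
  rw [one_div_tau] at hgap ⊢
  obtain ⟨a, b, hxa, hx0, hx1⟩ := (negInt_tau_iff x).1 hx
  obtain ⟨a', b', hya, hy0, -⟩ := (negInt_tau_iff y).1 hy
  obtain ⟨rfl, rfl⟩ : a' = a - 1 ∧ b' = b + 1 :=
    int_add_int_mul_tau_inj (by push_cast; linarith)
  push_cast at hy0
  have hxm : tau ^ 2 * x = (a + b : ℤ) + (a + 2 * b : ℤ) * tau := by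
    rw [hxa]; push_cast
    linear_combination (a + b + b * tau : ℝ) * hsq
  have hym : tau ^ 2 * y = tau ^ 2 * x + 1 + (tau - 1) := by
    linear_combination tau ^ 2 * hgap + (tau : ℝ) * hsq
  have hconj : ((a + b : ℤ) : ℝ) + (a + 2 * b : ℤ) * (1 - tau)
      = (2 - tau) * (a + b * (1 - tau)) := by
    push_cast
    linear_combination (-b : ℝ) * hsq
  have hlo : tau - 1 ≤ ((a + b : ℤ) : ℝ) + (a + 2 * b : ℤ) * (1 - tau) := by
    rw [hconj]; nlinarith
  have hhi : ((a + b : ℤ) : ℝ) + (a + 2 * b : ℤ) * (1 - tau) < 1 := by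
    rw [hconj]; nlinarith
  refine ⟨?_, hym⟩
  rw [hym, hxm]
  generalize a + b = p at *
  generalize a + 2 * b = q at *
  ext w
  simp only [Set.mem_inter_iff, Set.mem_Icc, Set.mem_ofPred_eq, Set.mem_insert_iff,
    Set.mem_singleton_iff, negInt_tau_iff]
  constructor
  · rintro ⟨⟨w0, w1⟩, c, d, rfl, hc0, hc1⟩
    obtain ⟨A, rfl⟩ : ∃ A : ℤ, c = p + A := ⟨c - p, by ring⟩
    obtain ⟨B, rfl⟩ : ∃ B : ℤ, d = q + B := ⟨d - q, by ring⟩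
    push_cast at *
    have hB1 : B < 2 := by
      by_contra! h
      have : (2 : ℝ) ≤ B := by exact_mod_cast h
      nlinarith
    have hB2 : -1 < B := by
      by_contra! h
      have : (B : ℝ) ≤ -1 := by exact_mod_cast h
      nlinarith
    interval_cases B
    · have h1 : -1 < A := by
        have : (-1 : ℝ) < A := by push_cast at *; linarith
        exact_mod_cast this
      have h2 : A < 2 := by
        have : (A : ℝ) < 2 := by push_cast at *; linarith
        exact_mod_cast this
      interval_cases A
      · left; simp
      · right; left; push_cast; ring
    · have h1 : -1 < A := by
        have : (-1 : ℝ) < A := by push_cast at *; linarith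
        exact_mod_cast this
      have h2 : A < 1 := by
        have : (A : ℝ) < 1 := by push_cast at *; linarith
        exact_mod_cast this
      obtain rfl : A = 0 := by omega
      right; right; push_cast; ring
  · rintro (rfl | rfl | rfl)
    · exact ⟨⟨by linarith, by linarith⟩, p, q, rfl, by linarith, by linarith⟩
    · refine ⟨⟨by linarith, by linarith⟩, p + 1, q, ?_, ?_, ?_⟩ <;> push_cast <;> linarith
    · refine ⟨⟨by linarith, by linarith⟩, p, q + 1, ?_, ?_, ?_⟩ <;> push_cast <;> linarith
end

section
/- Let m, n be integers with m ≥ n ≥ 1 and let β > 1 be the positive root of x² - mx - n. Then the Ito–Sadahiro digit sequence of the left endpoint l_β is d₁(l_β) = m and d_j(l_β) = m - n for every j ≥ 2, i.e., d_{-β}(l_β) = m (m-n)^ω. -/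
theorem negDigit_left_endpoint_zero {m : ℤ} {β : ℝ} (hβ : 0 < β) (hm : (m : ℝ) ≤ β)
    (hm' : β < m + 1) : negDigit β (-β / (β + 1)) 0 = m := by
  have h : -β * (-β / (β + 1)) - -β / (β + 1) = β := by field_simp; ring
  rw [negDigit, Function.iterate_zero_apply, h, Int.floor_eq_iff]
  exact ⟨hm, hm'⟩

theorem negT_eq_sub_negDigit (β x : ℝ) : negT β x = -β * x - negDigit β x 0 := rfl

/-- The point `-k / (β + 1)`, fixed by `T_{-β}` when `0 ≤ k ≤ β`, has first digit `k`. -/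
theorem negDigit_neg_div_zero {k : ℤ} {β : ℝ} (hβ : 0 < β) (hk : 0 ≤ k) (hkβ : (k : ℝ) ≤ β) :
    negDigit β (-k / (β + 1)) 0 = k := by
  have hk' : (0 : ℝ) ≤ k := by exact_mod_cast hk
  have h : -β * (-k / (β + 1)) - -β / (β + 1) = β * (k + 1) / (β + 1) := by field_simp; ring
  have hpos : 0 < β + 1 := by linarith
  rw [negDigit, Function.iterate_zero_apply, h, Int.floor_eq_iff, le_div_iff₀ hpos,
    div_lt_iff₀ hpos]
  constructor <;> nlinarith

theorem negT_neg_div {k : ℤ} {β : ℝ} (hβ : 0 < β) (hk : 0 ≤ k) (hkβ : (k : ℝ) ≤ β) :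
    negT β (-k / (β + 1)) = -k / (β + 1) := by
  rw [negT_eq_sub_negDigit, negDigit_neg_div_zero hβ hk hkβ]
  field_simp
  ring

/-- For `β > 1` the positive root of `x² - mx - n`, `m ≥ n ≥ 1`,
the Ito–Sadahiro digit string of `l_β = -β/(β+1)` is `m (m-n)^ω`.  Here
`negDigit β l_β i = d_{i+1}(l_β)`, so the claim reads `d_1(l_β) = m` and
`d_{i+1}(l_β) = m - n` for all `i ≥ 1`. -/
theorem digits_of_left_endpoint
    (m n : ℤ) (hn : 1 ≤ n) (hmn : n ≤ m) (β : ℝ) (hβ : 1 < β)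
    (hroot : β ^ 2 - (m : ℝ) * β - (n : ℝ) = 0) :
    negDigit β (-β / (β + 1)) 0 = m ∧
      ∀ i : ℕ, 1 ≤ i → negDigit β (-β / (β + 1)) i = m - n := by
  have hβ0 : 0 < β := by linarith
  have hn' : (1 : ℝ) ≤ n := by exact_mod_cast hn
  have hmn' : (n : ℝ) ≤ m := by exact_mod_cast hmn
  have hm : (m : ℝ) < β := by nlinarith
  have hm' : β < m + 1 := by nlinarith
  have h0 : negDigit β (-β / (β + 1)) 0 = m := negDigit_left_endpoint_zero hβ0 hm.le hm'
  have hk : 0 ≤ m - n := by omega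
  have hkβ : ((m - n : ℤ) : ℝ) ≤ β := by push_cast; linarith
  have hT : negT β (-β / (β + 1)) = -(m - n : ℤ) / (β + 1) := by
    rw [negT_eq_sub_negDigit, h0]
    push_cast
    field_simp
    linarith
  refine ⟨h0, fun i hi => ?_⟩
  obtain ⟨j, rfl⟩ := Nat.exists_eq_add_of_le' hi
  have hiter : (negT β)^[j + 1] (-β / (β + 1)) = -(m - n : ℤ) / (β + 1) := by
    rw [Function.iterate_succ_apply, hT, Function.iterate_fixed (negT_neg_div hβ0 hk hkβ)]
  rw [negDigit, hiter]
  exact negDigit_neg_div_zero hβ0 hk hkβ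
end
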